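/- Every transitive subgroup of S₇ that is not contained in the alternating group A₇ is isomorphic to one of: the dihedral group D₇ of order 14, the affine group AGL₁(𝔽₇) of order 42, or S₇ itself. -/

import Mathlib

namespace S7aux

open Equiv Equiv.Perm
open scoped Fin.CommRing

/-- value-level word evaluation -/
def ev (t : ℕ → ℕ) (w : List ℕ) (x : ℕ) : ℕ := w.foldr (fun k y => t ((y + k) % 7)) x

def bad (t : ℕ → ℕ) (w : List ℕ) (i : ℕ) : ℕ := bif Nat.beq (ev t w i) i then 0 else 1

def cnt (t : ℕ → ℕ) (w : List ℕ) : ℕ :=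
  bad t w 0 + bad t w 1 + bad t w 2 + bad t w 3 + bad t w 4 + bad t w 5 + bad t w 6

def inv (t : ℕ → ℕ) (i j : ℕ) : ℕ := bif Nat.blt (t i) (t j) then 0 else 1

def invs (t : ℕ → ℕ) : ℕ :=
  inv t 0 1 + inv t 0 2 + inv t 1 2 + inv t 0 3 + inv t 1 3 + inv t 2 3 +
  inv t 0 4 + inv t 1 4 + inv t 2 4 + inv t 3 4 +
  inv t 0 5 + inv t 1 5 + inv t 2 5 + inv t 3 5 + inv t 4 5 +
  inv t 0 6 + inv t 1 6 + inv t 2 6 + inv t 3 6 + inv t 4 6 + inv t 5 6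

def words : List (List ℕ) :=
  [[0,0,0],[1,1,1,1],[3,3,3,3],[1,1,1,1,1],[6,6,6,6,6],[4,4,4,4,4],[2,2,2,2,2],
   [0,4,0,4],[0,1,0,1],[0,2,0,2],[0,3,0,3],[0,5,0,5],[0,6,0,6],[1,6,1,6]]

def aff (t : ℕ → ℕ) : Bool :=
  [0,1,2,3,4,5,6].all fun x => Nat.beq (t x) (t 1 * x % 7)

def leaf (t : ℕ → ℕ) : Bool :=
  Nat.beq (invs t % 2) 0 || (aff t || words.any fun w =>
    Nat.beq (cnt t w) 2 || Nat.beq (cnt t w) 3)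

def tt (a b c d e f : ℕ) : ℕ → ℕ := fun x => [0,a,b,c,d,e,f].getD x 0

def R : List ℕ := [1,2,3,4,5,6]

def full : Bool :=
  R.all fun a => R.all fun b => Nat.beq b a || R.all fun c => Nat.beq c a || (Nat.beq c b ||
  R.all fun d => Nat.beq d a || (Nat.beq d b || (Nat.beq d c ||
  R.all fun e => Nat.beq e a || (Nat.beq e b || (Nat.beq e c || (Nat.beq e d ||
  R.all fun f => Nat.beq f a || (Nat.beq f b || (Nat.beq f c || (Nat.beq f d || (Nat.beq f e ||
    leaf (tt a b c d e f)))))))))))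

theorem full_true : full = true := by decide +kernel

def s : Perm (Fin 7) := finRotate 7

theorem s_apply (x : Fin 7) : s x = x + 1 := by simp [s]

theorem s_pow (k : ℕ) (x : Fin 7) : (s ^ k) x = x + (k : Fin 7) := by
  induction k with
  | zero => simp
  | succ n ih => rw [pow_succ', Perm.mul_apply, ih, s_apply, Nat.cast_succ, add_assoc]

def wprod (τ : Perm (Fin 7)) (w : List ℕ) : Perm (Fin 7) := (w.map fun k => τ * s ^ k).prod

theorem wprod_val (τ : Perm (Fin 7)) (t : ℕ → ℕ) (ht : ∀ x : Fin 7, (τ x).val = t x.val)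
    (w : List ℕ) (x : Fin 7) : (wprod τ w x).val = ev t w x.val := by
  induction w with
  | nil => simp [wprod, ev]
  | cons k w ih =>
    have : wprod τ (k :: w) = τ * s ^ k * wprod τ w := by simp [wprod]
    rw [this, Perm.mul_apply, Perm.mul_apply, ht, s_pow, Fin.val_add, ih, Fin.val_natCast]
    simp [ev]

theorem cnt_eq (τ : Perm (Fin 7)) (t : ℕ → ℕ) (ht : ∀ x : Fin 7, (τ x).val = t x.val)
    (w : List ℕ) : (wprod τ w).support.card = cnt t w := by
  have h : ∀ x : Fin 7, (if wprod τ w x ≠ x then 1 else 0) = bad t w x.val := by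
    intro x
    rw [bad, ← wprod_val τ t ht]
    by_cases hx : wprod τ w x = x
    · simp [hx]
    · have : ¬ (wprod τ w x).val = x.val := fun h => hx (Fin.ext h)
      have h2 : Nat.beq (wprod τ w x).val x.val = false := by
        rw [← Bool.not_eq_true, Nat.beq_eq]; exact this
      simp [hx, h2]
  rw [Perm.support, Finset.card_filter, Finset.sum_congr rfl (fun x _ => h x), Fin.sum_univ_seven]
  rfl

theorem sign_eq (τ : Perm (Fin 7)) (t : ℕ → ℕ) (ht : ∀ x : Fin 7, (τ x).val = t x.val) :
    sign τ = (-1) ^ invs t := by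
  have h : ∀ i j : Fin 7, (if τ i < τ j then (1 : ℤˣ) else -1) = (-1) ^ inv t i.val j.val := by
    intro i j
    rw [inv, ← ht, ← ht]
    by_cases hx : τ i < τ j
    · have h2 : Nat.blt (τ i).val (τ j).val = true := by rw [Nat.blt_eq]; exact hx
      simp [hx, h2]
    · have h2 : Nat.blt (τ i).val (τ j).val = false := by
        rw [← Bool.not_eq_true, Nat.blt_eq]; exact hx
      simp [hx, h2]
  rw [sign_eq_prod_prod_Iio]
  simp only [h]
  have e0 : Finset.Iio (0 : Fin 7) = ∅ := by decide
  have e1 : Finset.Iio (1 : Fin 7) = {0} := by decide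
  have e2 : Finset.Iio (2 : Fin 7) = {0,1} := by decide
  have e3 : Finset.Iio (3 : Fin 7) = {0,1,2} := by decide
  have e4 : Finset.Iio (4 : Fin 7) = {0,1,2,3} := by decide
  have e5 : Finset.Iio (5 : Fin 7) = {0,1,2,3,4} := by decide
  have e6 : Finset.Iio (6 : Fin 7) = {0,1,2,3,4,5} := by decide
  rw [Fin.prod_univ_seven, e0, e1, e2, e3, e4, e5, e6]
  simp only [Finset.prod_pow_eq_pow_sum, ← pow_add]
  congr 1
  simp [invs, Finset.sum_insert, add_assoc]

theorem key (τ : Perm (Fin 7)) (h0 : τ 0 = 0) (hs : sign τ = -1) :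
    (∃ a : Fin 7, ∀ x, τ x = a * x) ∨
      ∃ w, (wprod τ w).support.card = 2 ∨ (wprod τ w).support.card = 3 := by
  have hne : ∀ i j : Fin 7, i ≠ j → Nat.beq (τ i).val (τ j).val = false := by
    intro i j hij
    rw [← Bool.not_eq_true, Nat.beq_eq]
    exact fun h => hij (τ.injective (Fin.ext h))
  have hR : ∀ i : Fin 7, i ≠ 0 → (τ i).val ∈ R := by
    intro i hi
    have h1 : τ i ≠ 0 := fun h => hi (τ.injective (h.trans h0.symm))
    revert h1
    generalize τ i = y
    revert y
    decide
  have hf := full_true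
  simp only [full, List.all_eq_true, Bool.or_eq_true] at hf
  have H1 := hf _ (hR 1 (by decide)) _ (hR 2 (by decide))
  simp only [hne 2 1 (by decide), Bool.false_eq_true, false_or] at H1
  have H2 := H1 _ (hR 3 (by decide))
  simp only [hne 3 1 (by decide), hne 3 2 (by decide), Bool.false_eq_true, false_or] at H2
  have H3 := H2 _ (hR 4 (by decide))
  simp only [hne 4 1 (by decide), hne 4 2 (by decide), hne 4 3 (by decide),
    Bool.false_eq_true, false_or] at H3
  have H4 := H3 _ (hR 5 (by decide))
  simp only [hne 5 1 (by decide), hne 5 2 (by decide), hne 5 3 (by decide), hne 5 4 (by decide),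
    Bool.false_eq_true, false_or] at H4
  have H5 := H4 _ (hR 6 (by decide))
  simp only [hne 6 1 (by decide), hne 6 2 (by decide), hne 6 3 (by decide), hne 6 4 (by decide),
    hne 6 5 (by decide), Bool.false_eq_true, false_or] at H5
  generalize htt : tt (τ 1).val (τ 2).val (τ 3).val (τ 4).val (τ 5).val (τ 6).val = t at H5
  have ht : ∀ x : Fin 7, (τ x).val = t x.val := by
    intro x
    subst htt
    fin_cases x
    · exact congrArg Fin.val h0
    all_goals rfl
  simp only [leaf, Bool.or_eq_true, Nat.beq_eq, List.any_eq_true] at H5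
  rcases H5 with h | h | ⟨w, -, h⟩
  · rw [sign_eq τ t ht, (Nat.even_iff.mpr h).neg_one_pow] at hs
    exact absurd hs (by decide)
  · left
    refine ⟨τ 1, fun x => Fin.ext ?_⟩
    simp only [aff, List.all_eq_true, Nat.beq_eq] at h
    rw [Fin.val_mul, ht, ht]
    refine h _ ?_
    revert x
    decide
  · right
    exact ⟨w, by rwa [cnt_eq τ t ht]⟩

/-- affine with multiplier `a` -/
def L (τ : Perm (Fin 7)) (a : Fin 7) : Prop := ∀ x, τ x = a * x + τ 0

theorem L_mul {τ ρ : Perm (Fin 7)} {a c : Fin 7} (h : L τ a) (h' : L ρ c) :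
    L (τ * ρ) (a * c) := by
  intro x
  have e1 := h (ρ x)
  have e2 := h (ρ 0)
  have e3 := h' x
  simp only [Perm.mul_apply]
  rw [e1, e2, e3]
  ring

theorem L_s : L s 1 := by intro x; simp [s_apply]

theorem L_same {H : Subgroup (Perm (Fin 7))} (hs : s ∈ H) {τ ρ : Perm (Fin 7)} {a : Fin 7}
    (h : L τ a) (h' : L ρ a) (hτ : τ ∈ H) : ρ ∈ H := by
  have : ρ = s ^ (ρ 0 - τ 0).val * τ := by
    ext1 x
    rw [Perm.mul_apply, s_pow, h x, h' x, Fin.cast_val_eq_self]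
    ring
  rw [this]
  exact H.mul_mem (H.pow_mem hs _) hτ

theorem L_ne {τ : Perm (Fin 7)} {a : Fin 7} (h : L τ a) : a ≠ 0 := by
  rintro rfl
  have := h 1
  simp at this

theorem sign_s : sign s = 1 := by decide

theorem L_one_sign {τ : Perm (Fin 7)} (h : L τ 1) : sign τ = 1 := by
  have : τ ∈ alternatingGroup (Fin 7) :=
    L_same (τ := s) (mem_alternatingGroup.mpr sign_s) L_s h (mem_alternatingGroup.mpr sign_s)
  exact mem_alternatingGroup.mp this

theorem L_odd {τ : Perm (Fin 7)} {a : Fin 7} (h : L τ a) (ho : sign τ = -1) :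
    a = 3 ∨ a = 5 ∨ a = 6 := by
  have h3 := L_mul h (L_mul h h)
  have : a * (a * a) ≠ 1 := by
    intro e
    rw [e] at h3
    have := L_one_sign h3
    rw [Perm.sign_mul, Perm.sign_mul, ho] at this
    exact absurd this (by decide)
  have h0 := L_ne h
  clear h3 h
  revert a
  decide

theorem exists_L {H : Subgroup (Perm (Fin 7))} (hs : s ∈ H)
    (hH : ∀ τ ∈ H, τ 0 = 0 → sign τ = -1 → ∃ a : Fin 7, ∀ x, τ x = a * x)
    (τ : Perm (Fin 7)) (hτ : τ ∈ H) (ho : sign τ = -1) : ∃ a, L τ a := by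
  obtain ⟨a, ha⟩ := hH (s ^ (- τ 0).val * τ) (H.mul_mem (H.pow_mem hs _) hτ)
    (by rw [Perm.mul_apply, s_pow, Fin.cast_val_eq_self]; ring)
    (by rw [Perm.sign_mul, map_pow, sign_s, one_pow, one_mul, ho])
  refine ⟨a, fun x => ?_⟩
  have := ha x
  rw [Perm.mul_apply, s_pow, Fin.cast_val_eq_self] at this
  rw [← this]; ring

theorem L_inv {τ : Perm (Fin 7)} {a : Fin 7} (h : L τ a) : ∃ c, L τ⁻¹ c := by
  have h0 := L_ne h
  obtain ⟨c, hc⟩ : ∃ c, c * a = 1 := by clear h; revert a; decide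
  refine ⟨c, fun x => ?_⟩
  have e1 := h (τ⁻¹ x)
  have e2 := h (τ⁻¹ 0)
  rw [← Perm.mul_apply, mul_inv_cancel, Perm.one_apply] at e1 e2
  have : τ⁻¹ x - τ⁻¹ 0 = c * x := by
    calc τ⁻¹ x - τ⁻¹ 0 = c * a * (τ⁻¹ x - τ⁻¹ 0) := by rw [hc, one_mul]
      _ = c * ((a * τ⁻¹ x + τ 0) - (a * τ⁻¹ 0 + τ 0)) := by ring
      _ = c * x := by rw [← e1, ← e2, sub_zero]
  rw [← this]; ring

def phi : (ZMod 7 ≃ᵃ[ZMod 7] ZMod 7) →* Perm (Fin 7) where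
  toFun e := e.toEquiv
  map_one' := rfl
  map_mul' _ _ := rfl

theorem phi_inj : Function.Injective phi := fun _ _ h => AffineEquiv.toEquiv_injective h

theorem aff_formula (e : ZMod 7 ≃ᵃ[ZMod 7] ZMod 7) (x : ZMod 7) :
    e x = e.linear 1 * x + e 0 := by
  have h := e.map_vadd 0 x
  have h2 := e.linear.map_smul x 1
  simp only [vadd_eq_add, add_zero, smul_eq_mul, mul_one] at h h2
  rw [h, h2, mul_comm]

theorem phi_L (e : ZMod 7 ≃ᵃ[ZMod 7] ZMod 7) : L (phi e) (e.linear 1 : ZMod 7) :=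
  fun x => aff_formula e x

theorem L_phi {τ : Perm (Fin 7)} {a : Fin 7} (h : L τ a) : τ ∈ phi.range := by
  have : Fact (Nat.Prime 7) := ⟨by norm_num⟩
  refine ⟨⟨(τ : ZMod 7 ≃ ZMod 7),
    LinearEquiv.smulOfNeZero (ZMod 7) (ZMod 7) (a : ZMod 7) (L_ne h), ?_⟩, rfl⟩
  intro p v
  have : ∀ p v : Fin 7, τ (v + p) = a * v + τ p := by
    intro p v
    rw [h (v + p), h p]
    ring
  exact this p v

def psi : DihedralGroup 7 →* Perm (Fin 7) where
  toFun g := match g with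
    | .r i => (Equiv.addRight (i : Fin 7) : Perm (Fin 7))
    | .sr i => (Equiv.subLeft (-i : Fin 7) : Perm (Fin 7))
  map_one' := by ext x : 1; exact add_zero (x : Fin 7)
  map_mul' := by
    rintro (i | i) (j | j) <;> ext x : 1
    · exact (by intros; ring : ∀ x i j : Fin 7, x + (i + j) = (x + j) + i) x i j
    · exact (by intros; ring : ∀ x i j : Fin 7, -(j - i) - x = (-j - x) + i) x i j
    · exact (by intros; ring : ∀ x i j : Fin 7, -(i + j) - x = -i - (x + j)) x i j
    · exact (by intros; ring : ∀ x i j : Fin 7, x + (j - i) = -i - (-j - x)) x i j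

theorem psi_inj : Function.Injective psi := by
  have hr : ∀ (i x : Fin 7), psi (.r i) x = x + i := fun _ _ => rfl
  have hsr : ∀ (i x : Fin 7), psi (.sr i) x = -i - x := fun _ _ => rfl
  rintro (i | i) (j | j) h <;> change Fin 7 at i j
  all_goals
    have h0 := Equiv.congr_fun h (0 : Fin 7)
    have h1 := Equiv.congr_fun h (1 : Fin 7)
  · rw [hr i, hr j] at h0
    exact congrArg _ (add_left_cancel h0)
  · rw [hr i, hsr j] at h0 h1
    exfalso; clear h; revert h0 h1; revert i j; decide
  · rw [hsr i, hr j] at h0 h1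
    exfalso; clear h; revert h0 h1; revert i j; decide
  · rw [hsr i, hsr j] at h0
    exact congrArg _ (neg_injective (sub_left_injective h0))

theorem affine_case (H : Subgroup (Perm (Fin 7))) (hs : s ∈ H)
    (hodd : ∃ g ∈ H, sign g = -1)
    (hH : ∀ τ ∈ H, sign τ = -1 → ∃ a, L τ a) :
    H = psi.range ∨ H = phi.range := by
  obtain ⟨g, hg, hgo⟩ := hodd
  have hall : ∀ τ ∈ H, ∃ a, L τ a := by
    intro τ hτ
    rcases Int.units_eq_one_or (sign τ) with h | h
    · obtain ⟨a, ha⟩ := hH (g * τ) (H.mul_mem hg hτ) (by rw [Perm.sign_mul, h, hgo, mul_one])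
      obtain ⟨b, hb⟩ := hH g hg hgo
      obtain ⟨c, hc⟩ := L_inv hb
      refine ⟨c * a, ?_⟩
      have := L_mul hc ha
      rwa [inv_mul_cancel_left] at this
    · exact hH τ hτ h
  have M1 : ∃ τ ∈ H, L τ 1 := ⟨s, hs, L_s⟩
  have Mmul : ∀ a b, (∃ τ ∈ H, L τ a) → (∃ τ ∈ H, L τ b) → ∃ τ ∈ H, L τ (a * b) := by
    rintro a b ⟨τ, h1, h2⟩ ⟨ρ, h3, h4⟩
    exact ⟨_, H.mul_mem h1 h3, L_mul h2 h4⟩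
  by_cases h3 : ∃ τ ∈ H, L τ 3
  · right
    apply le_antisymm
    · intro τ hτ
      obtain ⟨a, ha⟩ := hall τ hτ
      exact L_phi ha
    · rintro _ ⟨e, rfl⟩
      have he := phi_L e
      generalize (e.linear 1 : ZMod 7) = a at he
      have Ma : ∃ τ ∈ H, L τ a := by
        have m2 := Mmul _ _ h3 h3
        have m6 := Mmul _ _ h3 m2
        have m4 := Mmul _ _ h3 m6
        have m5 := Mmul _ _ h3 m4
        have h0 := L_ne he
        have : ∀ a : Fin 7, a ≠ 0 → a = 1 ∨ a = 3 ∨ a = 3 * 3 ∨ a = 3 * (3 * 3) ∨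
          a = 3 * (3 * (3 * 3)) ∨ a = 3 * (3 * (3 * (3 * 3))) := by decide
        rcases this a h0 with h | h | h | h | h | h <;> rw [h] <;> assumption
      obtain ⟨τ, h1, h2⟩ := Ma
      exact L_same hs h2 he h1
  · left
    have h5 : ¬ ∃ τ ∈ H, L τ 5 := fun m =>
      h3 (Mmul 5 _ m (Mmul 5 _ m (Mmul 5 _ m (Mmul 5 5 m m))))
    have h6 : ∃ τ ∈ H, L τ 6 := by
      obtain ⟨a, ha⟩ := hall g hg
      rcases L_odd ha hgo with rfl | rfl | rfl
      · exact absurd ⟨g, hg, ha⟩ h3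
      · exact absurd ⟨g, hg, ha⟩ h5
      · exact ⟨g, hg, ha⟩
    have h2 : ¬ ∃ τ ∈ H, L τ 2 := fun m => h5 (Mmul 2 6 m h6)
    have h4 : ¬ ∃ τ ∈ H, L τ 4 := fun m => h3 (Mmul 4 6 m h6)
    apply le_antisymm
    · intro τ hτ
      obtain ⟨a, ha⟩ := hall τ hτ
      have h0 := L_ne ha
      have Ma : ∃ τ ∈ H, L τ a := ⟨τ, hτ, ha⟩
      have : a = 1 ∨ a = 6 := by
        have : ∀ a : Fin 7, a = 0 ∨ a = 1 ∨ a = 2 ∨ a = 3 ∨ a = 4 ∨ a = 5 ∨ a = 6 := by decide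
        rcases this a with rfl | rfl | rfl | rfl | rfl | rfl | rfl <;> tauto
      rcases this with rfl | rfl
      · refine ⟨.r (τ 0 : Fin 7), ?_⟩
        ext x : 1
        rw [ha x, one_mul]
        rfl
      · refine ⟨.sr (-τ 0 : Fin 7), ?_⟩
        ext x : 1
        rw [ha x]
        change -(-τ 0 : Fin 7) - x = 6 * x + τ 0
        have : (6 : Fin 7) = -1 := by decide
        rw [this]; ring
    · rintro _ ⟨i | i, rfl⟩
      · refine L_same hs L_s ?_ hs
        exact fun x => (by intros; ring : ∀ x i : Fin 7, x + i = 1 * x + (0 + i)) x i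
      · obtain ⟨τ, h1, h2⟩ := h6
        refine L_same hs h2 ?_ h1
        have : (6 : Fin 7) = -1 := by decide
        rw [this]
        exact fun x => (by intros; ring : ∀ x i : Fin 7, -i - x = -1 * x + (-i - 0)) x i

theorem main_s (H : Subgroup (Perm (Fin 7))) (hs : s ∈ H)
    (hodd : ∃ g ∈ H, sign g = -1) :
    H = psi.range ∨ H = phi.range ∨ H = ⊤ := by
  by_cases hc : ∀ τ ∈ H, τ 0 = 0 → sign τ = -1 → ∃ a : Fin 7, ∀ x, τ x = a * x
  · rcases affine_case H hs hodd (exists_L hs hc) with h | h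
    · exact Or.inl h
    · exact Or.inr (Or.inl h)
  right; right
  push Not at hc
  obtain ⟨τ, hτ, h0, ho, hna⟩ := hc
  have hpt : MulAction.IsPretransitive H (Fin 7) := by
    refine ⟨fun x y => ⟨⟨s ^ (y - x).val, H.pow_mem hs _⟩, ?_⟩⟩
    change (s ^ (y - x).val) x = y
    rw [s_pow, Fin.cast_val_eq_self]; ring
  have hpp : MulAction.IsPreprimitive H (Fin 7) :=
    MulAction.IsPreprimitive.of_prime_card (by rw [Nat.card_fin]; norm_num)
  rcases key τ h0 ho with ⟨a, ha⟩ | ⟨w, hw⟩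
  · obtain ⟨x, hx⟩ := hna a
    exact absurd (ha x) hx
  have hwH : wprod τ w ∈ H := by
    apply Subgroup.list_prod_mem
    intro x hx
    obtain ⟨k, -, rfl⟩ := List.mem_map.mp hx
    exact H.mul_mem hτ (H.pow_mem hs _)
  rcases hw with hw | hw
  · exact subgroup_eq_top_of_isPreprimitive_of_isSwap_mem hpp _ (card_support_eq_two.mp hw) hwH
  · have hA := alternatingGroup_le_of_isPreprimitive_of_isThreeCycle_mem hpp
      (card_support_eq_three_iff.mp hw) hwH
    rw [eq_top_iff]
    intro g _
    rcases Int.units_eq_one_or (sign g) with h | h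
    · exact hA (mem_alternatingGroup.mpr h)
    · have : τ * g ∈ H := hA (mem_alternatingGroup.mpr (by rw [Perm.sign_mul, h, ho]; decide))
      exact (H.mul_mem_cancel_left hτ).mp this

theorem exists_conj (H : Subgroup (Perm (Fin 7)))
    (htrans : ∀ i j : Fin 7, ∃ g ∈ H, g i = j) : ∃ g : Perm (Fin 7), ∃ c ∈ H, g * c * g⁻¹ = s := by
  have hpt : MulAction.IsPretransitive H (Fin 7) :=
    ⟨fun x y => by obtain ⟨g, hg, h⟩ := htrans x y; exact ⟨⟨g, hg⟩, h⟩⟩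
  have hd : 7 ∣ Nat.card H := by
    have := MulAction.index_stabilizer_of_transitive H (0 : Fin 7)
    rw [Nat.card_fin] at this
    have h2 := Subgroup.index_dvd_card (MulAction.stabilizer H (0 : Fin 7))
    rwa [this] at h2
  have : Fact (Nat.Prime 7) := ⟨by norm_num⟩
  obtain ⟨c, hc⟩ := exists_prime_orderOf_dvd_card' 7 hd
  have hc' : orderOf (c : Perm (Fin 7)) = 7 := by rw [Subgroup.orderOf_coe, hc]
  have hcyc : IsCycle (c : Perm (Fin 7)) :=
    isCycle_of_prime_order'' (by rw [Fintype.card_fin]; norm_num) (by rw [hc', Fintype.card_fin])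
  have hcs : IsCycle s := isCycle_finRotate
  have hconj : IsConj (c : Perm (Fin 7)) s := by
    apply hcyc.isConj hcs
    rw [← hcyc.orderOf, hc']
    simp [s, support_finRotate]
  obtain ⟨g, hg⟩ := isConj_iff.mp hconj
  exact ⟨g, c, c.2, hg⟩

end S7aux

/-- Every transitive subgroup of `S₇` not contained in `A₇` is isomorphic to the dihedral
group `D₇` of order 14, the affine group `AGL₁(𝔽₇)` of order 42, or `S₇` itself. -/
theorem transitive_subgroup_of_S7_not_in_A7
    (H : Subgroup (Equiv.Perm (Fin 7)))
    (htrans : ∀ i j : Fin 7, ∃ g ∈ H, g i = j)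
    (hodd : ¬ H ≤ alternatingGroup (Fin 7)) :
    Nonempty (↥H ≃* DihedralGroup 7) ∨
      Nonempty (↥H ≃* (ZMod 7 ≃ᵃ[ZMod 7] ZMod 7)) ∨
      Nonempty (↥H ≃* Equiv.Perm (Fin 7)) := by
  obtain ⟨g, c, hc, hgc⟩ := S7aux.exists_conj H htrans
  have e : H ≃* H.map (MulAut.conj g).toMonoidHom :=
    H.equivMapOfInjective _ (MulAut.conj g).injective
  have hs : S7aux.s ∈ H.map (MulAut.conj g).toMonoidHom := ⟨c, hc, by simpa using hgc⟩
  have ho : ∃ k ∈ H.map (MulAut.conj g).toMonoidHom, Equiv.Perm.sign k = -1 := by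
    obtain ⟨k, hk, hk'⟩ := SetLike.not_le_iff_exists.mp hodd
    refine ⟨g * k * g⁻¹, ⟨k, hk, by simp⟩, ?_⟩
    rw [Equiv.Perm.mem_alternatingGroup] at hk'
    have := (Int.units_eq_one_or (Equiv.Perm.sign k)).resolve_left hk'
    rw [Equiv.Perm.sign_mul, Equiv.Perm.sign_mul, Equiv.Perm.sign_inv, this, mul_comm, ← mul_assoc,
      Int.units_mul_self, one_mul]
  rcases S7aux.main_s _ hs ho with h | h | h
  · left
    exact ⟨e.trans ((MulEquiv.subgroupCongr h).trans
      (MonoidHom.ofInjective S7aux.psi_inj).symm)⟩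
  · right; left
    exact ⟨e.trans ((MulEquiv.subgroupCongr h).trans
      (MonoidHom.ofInjective S7aux.phi_inj).symm)⟩
  · right; right
    exact ⟨e.trans ((MulEquiv.subgroupCongr h).trans Subgroup.topEquiv)⟩
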